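/- Let n ≥ 2 and let (G;o) be a Menger algebra of rank n whose diagonal semigroup (G;·), x·y = x[y…y], is a group with identity element e, and define f : G^{n−1} → G by f(a₁,…,a_{n−1}) = e[a₁…a_{n−1}e]. Then, for fixed i with 1 ≤ i < n, the algebra (G;o) is i-solvable if and only if for all a₁,…,a_{i−1},a_{i+1},…,a_{n−1},aₙ ∈ G the equation f(a₁,…,a_{i−1},x,a_{i+1},…,a_{n−1}) = aₙ has a unique solution x ∈ G (Dudek's theorem). -/

import Mathlib

universe u

/-- Superassociativity of an `(n+1)`-ary operation, written `x[y₁…yₙ]`. -/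
def Superassociative {G : Type*} {n : ℕ} (o : G → (Fin n → G) → G) : Prop :=
  ∀ (x : G) (y z : Fin n → G), o (o x y) z = o x (fun i => o (y i) z)

/-- A Menger algebra of rank `n` is `i`-solvable if the equations
`x[a₁…aₙ] = b` and `a₀[a₁…a_{i-1} x a_{i+1}…aₙ] = b` have unique solutions. -/
def ISolvable {G : Type*} {n : ℕ} (o : G → (Fin n → G) → G) (i : Fin n) : Prop :=
  (∀ (a : Fin n → G) (b : G), ∃! x : G, o x a = b) ∧
  (∀ (a₀ : G) (a : Fin n → G) (b : G), ∃! x : G, o a₀ (Function.update a i x) = b)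

/-- The `(n-1)`-ary operation `f(a₁,…,a_{n-1}) = e[a₁…a_{n-1}e]` of the rigged
diagonal group. -/
def riggedOp {G : Type*} {n : ℕ} (o : G → (Fin n → G) → G) (e : G)
    (a : Fin (n - 1) → G) : G :=
  o e (fun j => if h : (j : ℕ) < n - 1 then a ⟨j, h⟩ else e)

/-- **Dudek's theorem.** Let the diagonal semigroup of a Menger algebra
`(G;o)` of rank `n ≥ 2` be a group with identity `e`, and let
`f(a₁,…,a_{n-1}) = e[a₁…a_{n-1}e]`. For fixed `1 ≤ i < n`, the algebra `(G;o)`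
is `i`-solvable if and only if the equation
`f(a₁,…,a_{i-1},x,a_{i+1},…,a_{n-1}) = aₙ` has a unique solution `x`. -/
theorem i_solvable_iff_rigged_solvable {G : Type u} {n : ℕ} (hn : 2 ≤ n)
    (o : G → (Fin n → G) → G) (hsa : Superassociative o)
    (e : G)
    (he : ∀ x : G, o e (fun _ => x) = x ∧ o x (fun _ => e) = x)
    (hinv : ∀ x : G, ∃ y : G, o x (fun _ => y) = e ∧ o y (fun _ => x) = e)
    (i : ℕ) (hi1 : 1 ≤ i) (hi2 : i < n) :
    ISolvable o ⟨i - 1, by omega⟩ ↔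
      ∀ (a : Fin (n - 1) → G) (an : G),
        ∃! x : G, riggedOp o e (Function.update a ⟨i - 1, by omega⟩ x) = an := by
  have hin : i - 1 < n := by omega
  have hnn : n - 1 < n := by omega
  have hK : ∀ x a, o x a = o x (fun _ => o e a) := fun x a => by
    have := hsa x (fun _ => e) a
    rwa [(he x).2] at this
  have hassoc : ∀ x y z : G, o (o x (fun _ => y)) (fun _ => z)
      = o x (fun _ => o y (fun _ => z)) := fun x y z => hsa x _ _
  have hup : ∀ (a : Fin (n - 1) → G) (x : G),
      riggedOp o e (Function.update a ⟨i - 1, by omega⟩ x) =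
      o e (Function.update (fun j : Fin n => if h : (j : ℕ) < n - 1 then a ⟨j, h⟩ else e)
        ⟨i - 1, by omega⟩ x) := by
    intro a x
    unfold riggedOp
    congr 1
    funext j
    by_cases hj : (j : ℕ) = i - 1
    · have : j = ⟨i - 1, hin⟩ := Fin.ext hj
      subst this
      have h : i - 1 < n - 1 := by omega
      simp [h]
    · have : j ≠ ⟨i - 1, by omega⟩ := fun h => hj (congrArg Fin.val h)
      rw [Function.update_of_ne this]
      by_cases h : (j : ℕ) < n - 1
      · have h2 : (⟨j, h⟩ : Fin (n - 1)) ≠ ⟨i - 1, by omega⟩ :=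
          fun h => hj (congrArg Fin.val h)
        simp only [h, dite_true]
        rw [Function.update_of_ne h2]
      · simp [h]
  constructor
  · rintro ⟨-, h⟩ a an
    simp only [hup]
    exact h e _ an
  · intro H
    refine ⟨fun a b => ?_, fun a₀ a b => ?_⟩
    · obtain ⟨w, hw1, hw2⟩ := hinv (o e a)
      refine ⟨o b (fun _ => w), ?_, fun x hx => ?_⟩
      · change o (o b (fun _ => w)) a = b
        rw [hK, hassoc, hw2, (he b).2]
      · change o x a = b at hx
        rw [hK] at hx
        rw [← hx, hassoc, hw1, (he x).2]
    · obtain ⟨v, hv1, hv2⟩ := hinv a₀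
      obtain ⟨w, hw1, hw2⟩ := hinv (a ⟨n - 1, by omega⟩)
      have key : ∀ x, o (o e (Function.update a ⟨i - 1, by omega⟩ x)) (fun _ => w) =
          riggedOp o e (Function.update
            (fun j : Fin (n - 1) => o (a ⟨j, by omega⟩) (fun _ => w))
            ⟨i - 1, by omega⟩ (o x (fun _ => w))) := by
        intro x
        rw [hup, hsa]
        congr 1
        funext j
        by_cases hj : j = ⟨i - 1, by omega⟩
        · subst hj
          simp
        · rw [Function.update_of_ne hj, Function.update_of_ne hj]
          by_cases h : (j : ℕ) < n - 1
          · simp [h]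
          · have : j = ⟨n - 1, hnn⟩ := Fin.ext (by have := j.2; simp only; omega)
            subst this
            simp [hw1]
      obtain ⟨y, hy, hyu⟩ := H (fun j : Fin (n - 1) => o (a ⟨j, by omega⟩) (fun _ => w))
        (o (o v (fun _ => b)) (fun _ => w))
      refine ⟨o y (fun _ => a ⟨n - 1, by omega⟩), ?_, fun x hx => ?_⟩
      · change o a₀ _ = b
        have h1 := key (o y (fun _ => a ⟨n - 1, by omega⟩))
        rw [hassoc y, hw1, (he y).2] at h1
        have h2 := h1.trans hy
        have h3 := congrArg (fun t => o t (fun _ => a ⟨n - 1, by omega⟩)) h2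
        simp only [hassoc _ w, hw2, (he _).2] at h3
        rw [hK, h3, ← hassoc, hv1, (he b).1]
      · change o a₀ _ = b at hx
        have h1 := hyu (o x (fun _ => w)) (by
          change riggedOp o e _ = _
          rw [← key, ← hx, hK a₀, ← hassoc v, hv2, (he _).1])
        rw [← h1, hassoc, hw2, (he x).2]
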